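/- Let Υ ∈ R^n_{++} and x ∈ dom(f_DDFact;Υ)_+. Let F_DDFact(x;Υ) = Q Diag(λ) Q^⊤ be a spectral decomposition with Q orthonormal and λ_1 ≥ … ≥ λ_{r'} > λ_{r'+1} = … = λ_k = 0, and let β ∈ R^k be given by β_i = 1/λ_i for i ≤ ι and β_i = (s−ι)/Σ_{ℓ=ι+1}^k λ_ℓ for i > ι, where ι is the unique integer of Lemma 1 for λ. Set g_x(x;Υ) = Υ ∘ diag(F Q Diag(β) Q^⊤ F^⊤) − log Υ. Then f_DDFact(·;Υ) is generalized differentiable at x with respect to dom(f_DDFact;Υ)_+ with generalized gradient g_x(x;Υ): for every ε > 0 there exists δ > 0 such that for all y ∈ dom(f_DDFact;Υ)_+ with ‖y−x‖ < δ, |f_DDFact(y;Υ) − f_DDFact(x;Υ) − g_x(x;Υ)^⊤(y−x)| ≤ ε‖y−x‖. Moreover g_x(x;Υ) does not depend on the choice of F or Q (with β adjusted accordingly). (Theorem 3.iii) -/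

import Mathlib

open Matrix
open scoped Matrix BigOperators Classical

noncomputable section

/-- `(1/(s−ι)) Σ_{ℓ=ι+1}^k λ_ℓ` (eigenvalues indexed from `1`). -/
def avgTail (k s : ℕ) (lam : ℕ → ℝ) (ι : ℕ) : ℝ :=
  (∑ ℓ ∈ Finset.Icc (ι + 1) k, lam ℓ) / ((s : ℝ) - ι)

/-- The defining property of the unique index `ι` of Lemma 1
(with the convention `λ_0 = +∞`, so for `ι = 0` the left inequality is vacuous). -/
def IsIota (k s : ℕ) (lam : ℕ → ℝ) (ι : ℕ) : Prop :=
  ι < s ∧ (1 ≤ ι → avgTail k s lam ι < lam ι) ∧ lam (ι + 1) ≤ avgTail k s lam ι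

/-- The unique index `ι` of Lemma 1 (junk value `0` if no such index exists). -/
def iotaOf (k s : ℕ) (lam : ℕ → ℝ) : ℕ :=
  if h : ∃ ι, IsIota k s lam ι then h.choose else 0

/-- `φ_s(λ) = Σ_{ℓ=1}^ι log λ_ℓ + (s−ι) log((1/(s−ι)) Σ_{ℓ=ι+1}^k λ_ℓ)`. -/
def phiS (k s : ℕ) (lam : ℕ → ℝ) : ℝ :=
  (∑ ℓ ∈ Finset.Icc 1 (iotaOf k s lam), Real.log (lam ℓ)) +
    ((s : ℝ) - iotaOf k s lam) * Real.log (avgTail k s lam (iotaOf k s lam))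

/-- The decreasingly ordered eigenvalues of a symmetric matrix, indexed from `1`
(junk value `0` outside `[1,k]` or if `X` is not Hermitian). -/
def eigsDesc (k : ℕ) (X : Matrix (Fin k) (Fin k) ℝ) : ℕ → ℝ := fun i =>
  if h : X.IsHermitian then
    ((((List.ofFn h.eigenvalues : List ℝ) : Multiset ℝ).sort (· ≤ ·)).reverse).getD (i - 1) 0
  else 0

/-- `Γ_s(X) = φ_s(λ(X))` with `λ(X)` the decreasingly ordered eigenvalues of `X`. -/
def gammaS (k s : ℕ) (X : Matrix (Fin k) (Fin k) ℝ) : ℝ :=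
  phiS k s (eigsDesc k X)

/-- `F_DDFact(x;Υ) = Fᵀ Diag(Υ∘x) F = Σ_i γ_i x_i F_{i·}ᵀ F_{i·}`. -/
def FDD (n k : ℕ) (F : Matrix (Fin n) (Fin k) ℝ) (x Υ : Fin n → ℝ) :
    Matrix (Fin k) (Fin k) ℝ :=
  Fᵀ * Matrix.diagonal (fun i => Υ i * x i) * F

/-- `f_DDFact(x;Υ) = Γ_s(F_DDFact(x;Υ)) − Σ_i x_i log γ_i`. -/
def fDD (n k s : ℕ) (F : Matrix (Fin n) (Fin k) ℝ) (x Υ : Fin n → ℝ) : ℝ :=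
  gammaS k s (FDD n k F x Υ) - ∑ i, x i * Real.log (Υ i)

/-- `β` of Definition 1: `β_i = 1/λ_i` for `i ≤ ι` and
`β_i = (s−ι)/Σ_{ℓ=ι+1}^k λ_ℓ` for `i > ι` (here `β` is indexed by `Fin k`, `j ↔ j+1`). -/
def betaOf (k s : ℕ) (lam : ℕ → ℝ) : Fin k → ℝ := fun j =>
  if (j : ℕ) + 1 ≤ iotaOf k s lam then (lam ((j : ℕ) + 1))⁻¹
  else ((s : ℝ) - iotaOf k s lam) / ∑ ℓ ∈ Finset.Icc (iotaOf k s lam + 1) k, lam ℓ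

/-- `F Q Diag(β) Qᵀ Fᵀ`, whose diagonal appears in the (generalized) gradients. -/
def gMat (n k s : ℕ) (F : Matrix (Fin n) (Fin k) ℝ) (Q : Matrix (Fin k) (Fin k) ℝ)
    (lam : ℕ → ℝ) : Matrix (Fin n) (Fin n) ℝ :=
  F * Q * Matrix.diagonal (betaOf k s lam) * Qᵀ * Fᵀ

/-- `Q, λ` form a spectral decomposition of `F_DDFact(x;Υ)` as in Definition 1:
`Q` orthonormal and `F_DDFact(x;Υ) = Q Diag(λ) Qᵀ` with `λ` decreasing and nonnegative
(indexed from `1`). -/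
def IsSpectralDecomp (n k : ℕ) (F : Matrix (Fin n) (Fin k) ℝ) (x Υ : Fin n → ℝ)
    (Q : Matrix (Fin k) (Fin k) ℝ) (lam : ℕ → ℝ) : Prop :=
  Q * Qᵀ = 1 ∧
  FDD n k F x Υ = Q * Matrix.diagonal (fun j : Fin k => lam ((j : ℕ) + 1)) * Qᵀ ∧
  (∀ i, 0 ≤ lam i) ∧
  (∀ i j, 1 ≤ i → i ≤ j → j ≤ k → lam j ≤ lam i)

/-- Euclidean (2-)norm of a vector in `ℝⁿ`. -/
def enorm2 (n : ℕ) (v : Fin n → ℝ) : ℝ :=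
  Real.sqrt (∑ i, (v i) ^ 2)

/-- `∑ⱼ min (Lⱼ / a) 1`, written as `∑ⱼ Lⱼ / max Lⱼ a`. -/
def cappedSum {k : ℕ} (a : ℝ) (L : Fin k → ℝ) : ℝ := ∑ j, L j / max (L j) a

/-- The objective whose minimum over `a > 0` is `φ_s`. -/
def capObjective {k : ℕ} (s : ℕ) (a : ℝ) (L : Fin k → ℝ) : ℝ :=
  ∑ j, (Real.log (max (L j) a) + L j / max (L j) a) - ((k : ℝ) - s) * Real.log a - s

/-- `a` is the largest solution of `cappedSum a L = s`. -/
structure IsThreshold {k : ℕ} (s : ℕ) (L : Fin k → ℝ) (a : ℝ) : Prop where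
  pos : 0 < a
  eq : cappedSum a L = s
  lt : ∀ c, a < c → cappedSum c L < s

/-- A doubly stochastic matrix of weights. -/
structure IsCoupling {k : ℕ} (w : Fin k → Fin k → ℝ) : Prop where
  nonneg : ∀ i j, 0 ≤ w i j
  row : ∀ i, ∑ j, w i j = 1
  col : ∀ j, ∑ i, w i j = 1

section Scalar

lemma log_sub_log_le {x y : ℝ} (hx : 0 < x) (hy : 0 < y) :
    Real.log x - Real.log y ≤ x / y - 1 := by
  rw [← Real.log_div hx.ne' hy.ne']
  exact Real.log_le_sub_one_of_pos (div_pos hx hy)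

lemma abs_inv_max_sub_inv_max_le {a b : ℝ} (ha : 0 < a) (hb : 0 < b) (t : ℝ) :
    |(max t b)⁻¹ - (max t a)⁻¹| ≤ |b - a| / (a * b) := by
  have hA : 0 < max t a := lt_max_of_lt_right ha
  have hB : 0 < max t b := lt_max_of_lt_right hb
  rw [inv_sub_inv hB.ne' hA.ne', abs_div, abs_of_pos (mul_pos hB hA)]
  have h1 : |max t a - max t b| ≤ |b - a| := by
    rw [abs_sub_comm b a]
    simpa using abs_max_sub_max_le_max t a t b
  have h2 : a * b ≤ max t b * max t a := by
    rw [mul_comm]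
    exact mul_le_mul (le_max_right _ _) (le_max_right _ _) ha.le hB.le
  exact div_le_div₀ (abs_nonneg _) h1 (mul_pos ha hb) h2

lemma abs_div_max_sub_div_max_le {c x y : ℝ} (hc : 0 < c) (hx : 0 ≤ x) (hy : 0 ≤ y) :
    |x / max x c - y / max y c| ≤ c⁻¹ * |x - y| := by
  wlog hxy : y ≤ x generalizing x y
  · rw [abs_sub_comm, abs_sub_comm x]
    exact this hy hx (le_of_not_ge hxy)
  have hX : 0 < max x c := lt_max_of_lt_right hc
  have hY : 0 < max y c := lt_max_of_lt_right hc
  rw [div_sub_div _ _ hX.ne' hY.ne', abs_of_nonneg (sub_nonneg.2 hxy), abs_div,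
    abs_of_pos (mul_pos hX hY), div_le_iff₀ (mul_pos hX hY)]
  rcases le_total x c with h1 | h1 <;> rcases le_total y c with h2 | h2
  · rw [max_eq_right h1, max_eq_right h2, show c⁻¹ * (x - y) * (c * c) = c * (x - y) by
      field_simp, abs_of_nonneg (by nlinarith)]
    linarith
  · have : x = c := le_antisymm h1 (h2.trans hxy)
    have : y = c := by linarith
    subst_vars
    simp
  · rw [max_eq_left h1, max_eq_right h2, show c⁻¹ * (x - y) * (x * c) = x * (x - y) by
      field_simp, abs_of_nonneg (by nlinarith)]
    nlinarith
  · rw [max_eq_left h1, max_eq_left h2, mul_comm x y, sub_self, abs_zero]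
    exact mul_nonneg (mul_nonneg (inv_pos.2 hc).le (by linarith)) (by positivity)

lemma div_max_anti {a c t : ℝ} (ha : 0 < a) (hac : a ≤ c) (ht : 0 ≤ t) :
    t / max t c ≤ t / max t a :=
  div_le_div_of_nonneg_left ht (lt_max_of_lt_right ha) (max_le_max le_rfl hac)

/-- Tangent inequality in the variable `log a`. -/
lemma cap_tangent_threshold {a c t : ℝ} (ha : 0 < a) (hc : 0 < c) (ht : 0 ≤ t) :
    Real.log (max t a) + t / max t a - Real.log a - t / max t a * (Real.log c - Real.log a) ≤
      Real.log (max t c) + t / max t c - Real.log c := by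
  rcases le_total t a with h1 | h1 <;> rcases le_total t c with h2 | h2
  · rw [max_eq_right h1, max_eq_right h2]
    have h := log_sub_log_le ha hc
    have e : t / a * (a / c - 1) = t / c - t / a := by field_simp
    nlinarith [mul_le_mul_of_nonneg_left h (div_nonneg ht ha.le)]
  · rw [max_eq_right h1, max_eq_left h2]
    have ht' : 0 < t := hc.trans_le h2
    rw [div_self ht'.ne']
    have h := log_sub_log_le ha ht'
    have e : t / a * (a / t - 1) = 1 - t / a := by field_simp
    have h3 := mul_le_mul_of_nonneg_left h (div_nonneg ht ha.le)
    have h4 : t / a ≤ 1 := (div_le_one ha).2 h1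
    have h5 : Real.log c ≤ Real.log t := Real.log_le_log hc h2
    nlinarith [mul_nonneg (sub_nonneg.2 h4) (sub_nonneg.2 h5)]
  · rw [max_eq_left h1, max_eq_right h2]
    have ht' : 0 < t := ha.trans_le h1
    rw [div_self ht'.ne']
    have h := log_sub_log_le ht' hc
    linarith
  · rw [max_eq_left h1, max_eq_left h2]
    have ht' : 0 < t := ha.trans_le h1
    rw [div_self ht'.ne']
    linarith

lemma cap_concave {a x y : ℝ} (ha : 0 < a) :
    Real.log (max y a) + y / max y a ≤
      Real.log (max x a) + x / max x a + (max x a)⁻¹ * (y - x) := by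
  have hX : 0 < max x a := lt_max_of_lt_right ha
  have hY : 0 < max y a := lt_max_of_lt_right ha
  have h := log_sub_log_le hY hX
  have key : (max y a - max x a) * (max y a - y) ≤ 0 := by
    rcases le_total y a with h1 | h1
    · rw [max_eq_right h1]
      exact mul_nonpos_of_nonpos_of_nonneg (sub_nonpos.2 (le_max_right _ _)) (by linarith)
    · rw [max_eq_left h1]; simp
  have e : max y a / max x a - 1 + y / max y a - y / max x a =
      (max y a - max x a) * (max y a - y) / (max x a * max y a) := by
    field_simp
    ring
  have h2 := div_nonpos_of_nonpos_of_nonneg key (mul_pos hX hY).le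
  have e2 : x / max x a + (max x a)⁻¹ * (y - x) = y / max x a := by
    field_simp
    ring
  linarith

lemma cap_quadratic_lower {a x y : ℝ} (ha : 0 < a) :
    Real.log (max x a) + x / max x a + (max x a)⁻¹ * (y - x) - (a ^ 2)⁻¹ * (x - y) ^ 2 ≤
      Real.log (max y a) + y / max y a := by
  have hX : 0 < max x a := lt_max_of_lt_right ha
  have hY : 0 < max y a := lt_max_of_lt_right ha
  have h := log_sub_log_le hX hY
  have key : -(x - y) ^ 2 ≤ (max y a - max x a) * (max x a - y) := by
    rcases le_total y a with h1 | h1 <;> rcases le_total x a with h2 | h2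
    · rw [max_eq_right h1, max_eq_right h2]; nlinarith [sq_nonneg (x - y)]
    · rw [max_eq_right h1, max_eq_left h2]
      nlinarith [mul_nonneg (sub_nonneg.2 h1) (sub_nonneg.2 (h1.trans h2))]
    · rw [max_eq_left h1, max_eq_right h2]
      nlinarith [mul_nonneg (sub_nonneg.2 h2) (sub_nonneg.2 h1),
        mul_nonneg (sub_nonneg.2 h2) (sub_nonneg.2 (h2.trans h1))]
    · rw [max_eq_left h1, max_eq_left h2]; nlinarith
  have e : 1 - max x a / max y a + y / max y a - y / max x a =
      (max y a - max x a) * (max x a - y) / (max x a * max y a) := by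
    field_simp
    ring
  have e2 : x / max x a + (max x a)⁻¹ * (y - x) = y / max x a := by
    field_simp
    ring
  have h3 : -((a ^ 2)⁻¹ * (x - y) ^ 2) ≤
      (max y a - max x a) * (max x a - y) / (max x a * max y a) := by
    have h4 : (x - y) ^ 2 / (max x a * max y a) ≤ (x - y) ^ 2 / a ^ 2 := by
      apply div_le_div_of_nonneg_left (sq_nonneg _) (by positivity)
      rw [sq]
      exact mul_le_mul (le_max_right _ _) (le_max_right _ _) ha.le hX.le
    have h5 := div_le_div_of_nonneg_right key (mul_pos hX hY).le
    rw [neg_div] at h5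
    rw [inv_mul_eq_div]
    linarith
  linarith

end Scalar

section Coupling

variable {k : ℕ} {w : Fin k → Fin k → ℝ}

lemma IsCoupling.sum_left (hw : IsCoupling w) (f : Fin k → ℝ) :
    ∑ i, ∑ j, w i j * f i = ∑ i, f i := by
  refine Finset.sum_congr rfl fun i _ => ?_
  rw [← Finset.sum_mul, hw.row, one_mul]

lemma IsCoupling.sum_right (hw : IsCoupling w) (f : Fin k → ℝ) :
    ∑ i, ∑ j, w i j * f j = ∑ j, f j := by
  rw [Finset.sum_comm]
  refine Finset.sum_congr rfl fun j _ => ?_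
  rw [← Finset.sum_mul, hw.col, one_mul]

lemma IsCoupling.sum_abs_le (hw : IsCoupling w) (L M : Fin k → ℝ) :
    ∑ i, ∑ j, w i j * |L i - M j| ≤ √k * √(∑ i, ∑ j, w i j * (L i - M j) ^ 2) := by
  rw [← Real.sqrt_mul (Nat.cast_nonneg k)]
  apply Real.le_sqrt_of_sq_le
  have h := Finset.sum_sq_le_sum_mul_sum_of_sq_le_mul (Finset.univ : Finset (Fin k × Fin k))
    (r := fun p => w p.1 p.2 * |L p.1 - M p.2|) (f := fun p => w p.1 p.2)
    (g := fun p => w p.1 p.2 * (L p.1 - M p.2) ^ 2)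
    (fun p _ => hw.nonneg _ _) (fun p _ => mul_nonneg (hw.nonneg _ _) (sq_nonneg _))
    (fun p _ => by rw [mul_pow, sq_abs, ← mul_assoc, ← sq])
  simp only [Fintype.sum_prod_type] at h
  simpa [hw.row] using h

lemma IsCoupling.abs_sum_sub_sum_le (hw : IsCoupling w) {L M : Fin k → ℝ}
    (hL : ∀ i, 0 ≤ L i) (hM : ∀ i, 0 ≤ M i) {h : ℝ → ℝ} {K : ℝ}
    (hh : ∀ x y, 0 ≤ x → 0 ≤ y → |h x - h y| ≤ K * |x - y|) :
    |∑ i, h (L i) - ∑ j, h (M j)| ≤ K * ∑ i, ∑ j, w i j * |L i - M j| := by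
  rw [← hw.sum_left (fun i => h (L i)), ← hw.sum_right (fun j => h (M j)),
    ← Finset.sum_sub_distrib, Finset.mul_sum]
  refine (Finset.abs_sum_le_sum_abs _ _).trans (Finset.sum_le_sum fun i _ => ?_)
  rw [← Finset.sum_sub_distrib, Finset.mul_sum]
  refine (Finset.abs_sum_le_sum_abs _ _).trans (Finset.sum_le_sum fun j _ => ?_)
  rw [← mul_sub, abs_mul, abs_of_nonneg (hw.nonneg i j), mul_left_comm]
  exact mul_le_mul_of_nonneg_left (hh _ _ (hL i) (hM j)) (hw.nonneg i j)

end Coupling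

section Threshold

variable {k s : ℕ} {L M : Fin k → ℝ} {a b : ℝ} {w : Fin k → Fin k → ℝ}

lemma IsThreshold.capObjective_le (h : IsThreshold s L a) (hL : ∀ i, 0 ≤ L i) {c : ℝ}
    (hc : 0 < c) : capObjective s a L ≤ capObjective s c L := by
  have h1 := Finset.sum_le_sum fun j (_ : j ∈ Finset.univ) =>
    cap_tangent_threshold h.pos hc (hL j)
  have h2 := h.eq
  simp only [Finset.sum_sub_distrib, ← Finset.sum_mul, Finset.sum_const, Finset.card_univ,
    Fintype.card_fin, nsmul_eq_mul] at h1
  unfold cappedSum at h2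
  rw [h2] at h1
  unfold capObjective
  linarith

lemma capObjective_le_add (hw : IsCoupling w) (ha : 0 < a) :
    capObjective s a M ≤ capObjective s a L +
      ∑ i, ∑ j, w i j * ((max (L i) a)⁻¹ * (M j - L i)) := by
  have h : ∑ i, ∑ j, w i j * (Real.log (max (M j) a) + M j / max (M j) a) ≤
      ∑ i, ∑ j, (w i j * (Real.log (max (L i) a) + L i / max (L i) a) +
        w i j * ((max (L i) a)⁻¹ * (M j - L i))) := by
    refine Finset.sum_le_sum fun i _ => Finset.sum_le_sum fun j _ => ?_
    rw [← mul_add]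
    exact mul_le_mul_of_nonneg_left (cap_concave ha) (hw.nonneg i j)
  simp only [Finset.sum_add_distrib (ι := Fin k)] at h
  simp only [mul_add, Finset.sum_add_distrib (ι := Fin k),
    hw.sum_left (fun i => Real.log (max (L i) a)),
    hw.sum_left (fun i => L i / max (L i) a),
    hw.sum_right (fun i => Real.log (max (M i) a)),
    hw.sum_right (fun i => M i / max (M i) a)] at h
  unfold capObjective
  simp only [Finset.sum_add_distrib]
  linarith

lemma add_sub_le_capObjective (hw : IsCoupling w) (ha : 0 < a) :
    capObjective s a L + ∑ i, ∑ j, w i j * ((max (L i) a)⁻¹ * (M j - L i)) -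
      (a ^ 2)⁻¹ * ∑ i, ∑ j, w i j * (L i - M j) ^ 2 ≤ capObjective s a M := by
  have h : ∑ i, ∑ j, (w i j * (Real.log (max (L i) a) + L i / max (L i) a) +
        w i j * ((max (L i) a)⁻¹ * (M j - L i)) - (a ^ 2)⁻¹ * (w i j * (L i - M j) ^ 2)) ≤
      ∑ i, ∑ j, w i j * (Real.log (max (M j) a) + M j / max (M j) a) := by
    refine Finset.sum_le_sum fun i _ => Finset.sum_le_sum fun j _ => ?_
    rw [← mul_add, mul_left_comm, ← mul_sub]
    exact mul_le_mul_of_nonneg_left (cap_quadratic_lower ha) (hw.nonneg i j)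
  simp only [Finset.sum_add_distrib, Finset.sum_sub_distrib] at h
  simp only [mul_add, Finset.sum_add_distrib (ι := Fin k),
    hw.sum_left (fun i => Real.log (max (L i) a)),
    hw.sum_left (fun i => L i / max (L i) a),
    hw.sum_right (fun i => Real.log (max (M i) a)),
    hw.sum_right (fun i => M i / max (M i) a), ← Finset.mul_sum] at h
  unfold capObjective
  simp only [Finset.sum_add_distrib]
  linarith

lemma cappedSum_anti (hL : ∀ i, 0 ≤ L i) (ha : 0 < a) (hab : a ≤ b) :
    cappedSum b L ≤ cappedSum a L :=
  Finset.sum_le_sum fun i _ => div_max_anti ha hab (hL i)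

lemma IsThreshold.eq_of_cappedSum_eq {k' : ℕ} {L' : Fin k' → ℝ} {a' : ℝ}
    (h : IsThreshold s L a) (h' : IsThreshold s L' a')
    (hS : ∀ c, 0 < c → cappedSum c L = cappedSum c L') : a = a' := by
  rcases lt_trichotomy a a' with hlt | heq | hgt
  · have := h.lt a' hlt
    rw [hS a' h'.pos, h'.eq] at this
    exact absurd this (lt_irrefl _)
  · exact heq
  · have := h'.lt a hgt
    rw [← hS a h.pos, h.eq] at this
    exact absurd this (lt_irrefl _)

/-- The threshold of a nearby spectrum is not much larger. -/
lemma IsThreshold.exists_upper (h : IsThreshold s L a) (hL : ∀ i, 0 ≤ L i) {η : ℝ}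
    (hη : 0 < η) : ∃ ρ > 0, ∀ (M : Fin k → ℝ) (w : Fin k → Fin k → ℝ) (b : ℝ),
      (∀ i, 0 ≤ M i) → IsCoupling w → IsThreshold s M b →
      ∑ i, ∑ j, w i j * |L i - M j| < ρ → b ≤ a + η := by
  have hc : 0 < a + η := add_pos h.pos hη
  have hlt := h.lt (a + η) (by linarith)
  refine ⟨(s - cappedSum (a + η) L) * (a + η), mul_pos (sub_pos.2 hlt) hc, ?_⟩
  intro M w b hM hw hb hd
  by_contra hcon
  have h1 := cappedSum_anti hM hc (le_of_not_ge hcon)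
  rw [hb.eq] at h1
  have h2 := hw.abs_sum_sub_sum_le hL hM
    (fun x y hx hy => abs_div_max_sub_div_max_le hc hx hy)
  have h3 := (abs_le.1 h2).1
  have h4 : (a + η)⁻¹ * ∑ i, ∑ j, w i j * |L i - M j| < s - cappedSum (a + η) L := by
    rw [inv_mul_lt_iff₀ hc, mul_comm]
    exact hd
  unfold cappedSum at *
  linarith

/-- The threshold of a nearby spectrum is not much smaller. -/
lemma IsThreshold.exists_lower (h : IsThreshold s L a) (hL : ∀ i, 0 ≤ L i) {η : ℝ}
    (hη : 0 < η) (hηa : η < a) : ∃ ρ > 0, ∀ (M : Fin k → ℝ) (w : Fin k → Fin k → ℝ) (b : ℝ),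
      (∀ i, 0 ≤ M i) → IsCoupling w → IsThreshold s M b →
      ∑ i, ∑ j, w i j * |L i - M j| < ρ → a - η ≤ b := by
  have hc : 0 < a - η := sub_pos.2 hηa
  by_cases hex : ∃ i, 0 < L i ∧ L i < a
  · obtain ⟨i₀, hi0, hia⟩ := hex
    have hlt : (s : ℝ) < cappedSum (a - η) L := by
      rw [← h.eq]
      refine Finset.sum_lt_sum (fun i _ => div_max_anti hc (by linarith) (hL i))
        ⟨i₀, Finset.mem_univ _, ?_⟩
      refine div_lt_div_of_pos_left hi0 (lt_max_of_lt_right hc) ?_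
      rw [max_eq_right hia.le]
      exact max_lt hia (by linarith)
    refine ⟨(cappedSum (a - η) L - s) * (a - η), mul_pos (sub_pos.2 hlt) hc, ?_⟩
    intro M w b hM hw hb hd
    by_contra hcon
    have h1 := hb.lt _ (lt_of_not_ge hcon)
    have h2 := hw.abs_sum_sub_sum_le hL hM
      (fun x y hx hy => abs_div_max_sub_div_max_le hc hx hy)
    have h3 := (abs_le.1 h2).2
    have h4 : (a - η)⁻¹ * ∑ i, ∑ j, w i j * |L i - M j| < cappedSum (a - η) L - s := by
      rw [inv_mul_lt_iff₀ hc, mul_comm]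
      exact hd
    unfold cappedSum at *
    linarith
  · push Not at hex
    let p : ℝ → ℝ := fun t => max 0 (min 1 (η⁻¹ * (t - (a - η))))
    have hp : ∀ x y, 0 ≤ x → 0 ≤ y → |p x - p y| ≤ η⁻¹ * |x - y| := by
      intro x y _ _
      calc |p x - p y| ≤ |min 1 (η⁻¹ * (x - (a - η))) - min 1 (η⁻¹ * (y - (a - η)))| := by
            simpa using abs_max_sub_max_le_max 0 (min 1 (η⁻¹ * (x - (a - η)))) 0
              (min 1 (η⁻¹ * (y - (a - η))))
        _ ≤ |η⁻¹ * (x - (a - η)) - η⁻¹ * (y - (a - η))| := by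
            simpa using abs_min_sub_min_le_max 1 (η⁻¹ * (x - (a - η))) 1
              (η⁻¹ * (y - (a - η)))
        _ = η⁻¹ * |x - y| := by
            rw [← mul_sub, abs_mul, abs_of_pos (inv_pos.2 hη)]
            congr 2
            ring
    have hpL : (s : ℝ) = ∑ i, p (L i) := by
      rw [← h.eq]
      refine Finset.sum_congr rfl fun i _ => ?_
      rcases (hL i).eq_or_lt with h0 | h0
      · have : η⁻¹ * (0 - (a - η)) ≤ 0 :=
          mul_nonpos_of_nonneg_of_nonpos (inv_pos.2 hη).le (by linarith)
        simp only [p, ← h0, zero_div]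
        exact (max_eq_left ((min_le_right _ _).trans this)).symm
      · have hai := hex i h0
        have h1 : 1 ≤ η⁻¹ * (L i - (a - η)) := by
          rw [inv_mul_eq_div, one_le_div hη]
          linarith
        simp only [p]
        rw [min_eq_left h1, max_eq_left hai, div_self h0.ne', max_eq_right zero_le_one]
    refine ⟨η, hη, ?_⟩
    intro M w b hM hw hb hd
    by_contra hcon
    have h1 := hb.lt _ (lt_of_not_ge hcon)
    have h2 := (abs_le.1 (hw.abs_sum_sub_sum_le hL hM hp)).2
    have h4 : η⁻¹ * ∑ i, ∑ j, w i j * |L i - M j| < 1 := by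
      rw [inv_mul_lt_iff₀ hη, mul_one]
      exact hd
    let T : Finset (Fin k) := Finset.univ.filter fun j => a - η < M j
    have hpM : ∑ j, p (M j) ≤ (T.card : ℝ) := by
      rw [Finset.card_filter, Nat.cast_sum]
      refine Finset.sum_le_sum fun j _ => ?_
      split_ifs with hj
      · simp [p]
      · have : η⁻¹ * (M j - (a - η)) ≤ 0 :=
          mul_nonpos_of_nonneg_of_nonpos (inv_pos.2 hη).le (by linarith)
        simp [p, this]
    have hTS : (T.card : ℝ) ≤ cappedSum (a - η) M := by
      rw [Finset.card_filter, Nat.cast_sum]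
      refine Finset.sum_le_sum fun j _ => ?_
      split_ifs with hj
      · rw [max_eq_left hj.le, div_self (hc.trans hj).ne']
        simp
      · simpa using div_nonneg (hM j) (hc.le.trans (le_max_right _ _))
    have h5 : (s : ℝ) < (T.card : ℝ) + 1 := by linarith
    have h6 : s ≤ T.card := by
      have : s < T.card + 1 := by exact_mod_cast h5
      omega
    have h7 : (s : ℝ) ≤ T.card := by exact_mod_cast h6
    linarith

end Threshold

/-- First-order expansion of the minimal value, uniformly over couplings with nearby spectra. -/
lemma IsThreshold.abs_capObjective_sub_le {k s : ℕ} {L : Fin k → ℝ} {a : ℝ}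
    (h : IsThreshold s L a) (hL : ∀ i, 0 ≤ L i) {ε : ℝ} (hε : 0 < ε) :
    ∃ ρ > 0, ∀ (M : Fin k → ℝ) (w : Fin k → Fin k → ℝ) (b : ℝ),
      (∀ i, 0 ≤ M i) → IsCoupling w → IsThreshold s M b →
      √(∑ i, ∑ j, w i j * (L i - M j) ^ 2) < ρ →
      |capObjective s b M - capObjective s a L -
        ∑ i, ∑ j, w i j * ((max (L i) a)⁻¹ * (M j - L i))| ≤
        ε * √(∑ i, ∑ j, w i j * (L i - M j) ^ 2) := by
  have ha := h.pos
  have hk : 0 < √(k : ℝ) + 1 := by positivity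
  set η := min (a / 2) (ε * a ^ 2 / (4 * (√(k : ℝ) + 1))) with hη
  have hη0 : 0 < η := by positivity
  have hηa : η ≤ a / 2 := min_le_left _ _
  have hηε : η * (4 * (√(k : ℝ) + 1)) ≤ ε * a ^ 2 :=
    (le_div_iff₀ (by positivity)).1 (min_le_right _ _)
  obtain ⟨ρ₁, hρ₁, H₁⟩ := h.exists_upper hL hη0
  obtain ⟨ρ₂, hρ₂, H₂⟩ := h.exists_lower hL hη0 (by linarith)
  refine ⟨min (min ρ₁ ρ₂ / (√(k : ℝ) + 1)) (ε * a ^ 2 / 8), by positivity, ?_⟩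
  intro M w b hM hw hb hR
  set R := √(∑ i, ∑ j, w i j * (L i - M j) ^ 2) with hRdef
  have hR0 : 0 ≤ R := Real.sqrt_nonneg _
  have hRsq : ∑ i, ∑ j, w i j * (L i - M j) ^ 2 = R ^ 2 :=
    (Real.sq_sqrt (Finset.sum_nonneg fun i _ => Finset.sum_nonneg fun j _ =>
      mul_nonneg (hw.nonneg i j) (sq_nonneg _))).symm
  have hR1 : R * (√(k : ℝ) + 1) < min ρ₁ ρ₂ :=
    (lt_div_iff₀ hk).1 (hR.trans_le (min_le_left _ _))
  have hR2 : R ≤ ε * a ^ 2 / 8 := (hR.trans_le (min_le_right _ _)).le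
  have hA : ∑ i, ∑ j, w i j * |L i - M j| ≤ √k * R := hw.sum_abs_le L M
  have hA' : ∑ i, ∑ j, w i j * |L i - M j| < min ρ₁ ρ₂ := by linarith
  have hb1 := H₁ M w b hM hw hb (hA'.trans_le (min_le_left _ _))
  have hb2 := H₂ M w b hM hw hb (hA'.trans_le (min_le_right _ _))
  have hba : |b - a| ≤ η := abs_le.2 ⟨by linarith, by linarith⟩
  have hb3 : a / 2 ≤ b := by linarith
  have upper := (hb.capObjective_le hM ha).trans (capObjective_le_add (L := L) hw ha)
  have lower := (sub_le_sub_right (add_le_add_left (h.capObjective_le hL hb.pos)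
    (∑ i, ∑ j, w i j * ((max (L i) b)⁻¹ * (M j - L i)))) _).trans
    (add_sub_le_capObjective (s := s) (L := L) (M := M) hw hb.pos)
  rw [hRsq] at lower
  have hdiff : |∑ i, ∑ j, w i j * ((max (L i) b)⁻¹ * (M j - L i)) -
      ∑ i, ∑ j, w i j * ((max (L i) a)⁻¹ * (M j - L i))| ≤
      |b - a| / (a * b) * ∑ i, ∑ j, w i j * |L i - M j| := by
    rw [← Finset.sum_sub_distrib, Finset.mul_sum]
    refine (Finset.abs_sum_le_sum_abs _ _).trans (Finset.sum_le_sum fun i _ => ?_)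
    rw [← Finset.sum_sub_distrib, Finset.mul_sum]
    refine (Finset.abs_sum_le_sum_abs _ _).trans (Finset.sum_le_sum fun j _ => ?_)
    rw [← mul_sub, ← sub_mul, abs_mul, abs_mul, abs_of_nonneg (hw.nonneg i j), mul_left_comm,
      abs_sub_comm (M j)]
    exact mul_le_mul_of_nonneg_right (abs_inv_max_sub_inv_max_le ha hb.pos _)
      (mul_nonneg (hw.nonneg i j) (abs_nonneg _))
  have hlin : |b - a| / (a * b) * ∑ i, ∑ j, w i j * |L i - M j| ≤ ε / 2 * R := by
    have h1 : |b - a| / (a * b) ≤ η / (a * (a / 2)) :=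
      div_le_div₀ hη0.le hba (by positivity) (mul_le_mul_of_nonneg_left hb3 ha.le)
    calc _ ≤ η / (a * (a / 2)) * (√k * R) :=
          mul_le_mul h1 hA (Finset.sum_nonneg fun i _ => Finset.sum_nonneg fun j _ =>
            mul_nonneg (hw.nonneg i j) (abs_nonneg _)) (by positivity)
      _ = η / (a * (a / 2)) * √k * R := by ring
      _ ≤ ε / 2 * R := by
          refine mul_le_mul_of_nonneg_right ?_ hR0
          rw [div_mul_eq_mul_div, div_le_iff₀ (by positivity)]
          nlinarith
  have hquad : (b ^ 2)⁻¹ * R ^ 2 ≤ ε / 2 * R := by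
    have h1 : (b ^ 2)⁻¹ ≤ ((a / 2) ^ 2)⁻¹ :=
      inv_anti₀ (by positivity) (pow_le_pow_left₀ (by positivity) hb3 2)
    calc (b ^ 2)⁻¹ * R ^ 2 ≤ ((a / 2) ^ 2)⁻¹ * R ^ 2 :=
          mul_le_mul_of_nonneg_right h1 (sq_nonneg _)
      _ = ((a / 2) ^ 2)⁻¹ * R * R := by ring
      _ ≤ ε / 2 * R := by
          refine mul_le_mul_of_nonneg_right ?_ hR0
          rw [inv_mul_le_iff₀ (by positivity)]
          linarith
  have hdiff' := (abs_le.1 (hdiff.trans hlin)).1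
  rw [abs_le]
  have : 0 ≤ ε * R := by positivity
  constructor <;> linarith

section Iota

variable {k s : ℕ} {lam : ℕ → ℝ}

lemma sum_fin_succ_eq_sum_Icc {ι : ℕ} (hι : ι ≤ k) (h : ℕ → ℝ) :
    ∑ j : Fin k, h ((j : ℕ) + 1) =
      ∑ ℓ ∈ Finset.Icc 1 ι, h ℓ + ∑ ℓ ∈ Finset.Icc (ι + 1) k, h ℓ := by
  rw [Fin.sum_univ_eq_sum_range (fun j => h (j + 1)) k, Finset.range_eq_Ico,
    Finset.sum_Ico_add' h 0 k 1, ← Finset.sum_Ico_consecutive h (show 0 + 1 ≤ ι + 1 by omega)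
      (show ι + 1 ≤ k + 1 by omega)]
  rfl

lemma exists_isIota (hs0 : 0 < s) (hsk : s ≤ k) (hlam : ∀ i, 0 ≤ lam i) :
    ∃ ι, IsIota k s lam ι := by
  have hex : ∃ ι, ι < s ∧ lam (ι + 1) ≤ avgTail k s lam ι := by
    refine ⟨s - 1, by omega, ?_⟩
    have hs : ((s : ℝ) - ((s - 1 : ℕ) : ℝ)) = 1 := by
      rw [Nat.cast_sub (by omega)]
      simp
    rw [avgTail, hs, div_one]
    exact Finset.single_le_sum (f := lam) (fun i _ => hlam i)
      (Finset.mem_Icc.2 ⟨le_rfl, by omega⟩)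
  refine ⟨Nat.find hex, (Nat.find_spec hex).1, fun h1 => ?_, (Nat.find_spec hex).2⟩
  obtain ⟨m, hm⟩ := Nat.exists_eq_add_of_le' h1
  have hlt : m + 1 < s := hm ▸ (Nat.find_spec hex).1
  have hmin := Nat.find_min hex (m := m) (by omega)
  rw [hm]
  have hgt : avgTail k s lam m < lam (m + 1) := by
    by_contra hcon
    exact hmin ⟨by omega, le_of_not_gt hcon⟩
  have hsm : (m : ℝ) + 1 < s := by exact_mod_cast hlt
  unfold avgTail at *
  rw [div_lt_iff₀ (by linarith),
    ← Finset.add_sum_Ioc_eq_sum_Icc (by omega : m + 1 ≤ k)] at hgt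
  rw [Nat.cast_add_one, div_lt_iff₀ (by linarith), Finset.Icc_add_one_left_eq_Ioc]
  linarith

lemma isIota_iotaOf (hs0 : 0 < s) (hsk : s ≤ k) (hlam : ∀ i, 0 ≤ lam i) :
    IsIota k s lam (iotaOf k s lam) := by
  have h := exists_isIota hs0 hsk hlam
  rw [iotaOf, dif_pos h]
  exact h.choose_spec

variable {ι : ℕ}

lemma IsIota.avgTail_pos (hι : IsIota k s lam ι) (hsk : s ≤ k)
    (hanti : ∀ i j, 1 ≤ i → i ≤ j → j ≤ k → lam j ≤ lam i) (hpos : 0 < lam s) :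
    0 < avgTail k s lam ι :=
  (hpos.trans_le (hanti _ _ (by omega) (by have := hι.1; omega) hsk)).trans_le hι.2.2

lemma IsIota.max_eq_left (hι : IsIota k s lam ι) (hsk : s ≤ k)
    (hanti : ∀ i j, 1 ≤ i → i ≤ j → j ≤ k → lam j ≤ lam i) {ℓ : ℕ} (h1 : 1 ≤ ℓ)
    (h2 : ℓ ≤ ι) : max (lam ℓ) (avgTail k s lam ι) = lam ℓ :=
  _root_.max_eq_left ((hι.2.1 (h1.trans h2)).le.trans
    (hanti _ _ h1 h2 (by have := hι.1; omega)))

lemma IsIota.max_eq_right (hι : IsIota k s lam ι)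
    (hanti : ∀ i j, 1 ≤ i → i ≤ j → j ≤ k → lam j ≤ lam i) {ℓ : ℕ} (h1 : ι + 1 ≤ ℓ)
    (h2 : ℓ ≤ k) : max (lam ℓ) (avgTail k s lam ι) = avgTail k s lam ι :=
  _root_.max_eq_right ((hanti _ _ (by omega) h1 h2).trans hι.2.2)

lemma IsIota.sum_eq (hι : IsIota k s lam ι) :
    ∑ ℓ ∈ Finset.Icc (ι + 1) k, lam ℓ = ((s : ℝ) - ι) * avgTail k s lam ι := by
  have : (ι : ℝ) < s := by exact_mod_cast hι.1
  rw [avgTail, mul_div_cancel₀]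
  linarith

lemma IsIota.sum_div_max (hι : IsIota k s lam ι) (hsk : s ≤ k)
    (hanti : ∀ i j, 1 ≤ i → i ≤ j → j ≤ k → lam j ≤ lam i) (hpos : 0 < lam s) :
    cappedSum (avgTail k s lam ι) (fun j : Fin k => lam ((j : ℕ) + 1)) = s := by
  have hιs := hι.1
  have ha := hι.avgTail_pos hsk hanti hpos
  rw [cappedSum, sum_fin_succ_eq_sum_Icc (show ι ≤ k by omega)
    (fun ℓ => lam ℓ / max (lam ℓ) (avgTail k s lam ι))]
  have e1 : ∑ ℓ ∈ Finset.Icc 1 ι, lam ℓ / max (lam ℓ) (avgTail k s lam ι) = ι := by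
    rw [Finset.sum_congr rfl (g := fun _ => (1 : ℝ))]
    · simp
    · intro ℓ hℓ
      obtain ⟨h1, h2⟩ := Finset.mem_Icc.1 hℓ
      have h3 := hι.max_eq_left hsk hanti h1 h2
      rw [h3, div_self]
      rw [← h3]
      exact (lt_max_of_lt_right ha).ne'
  have e2 : ∑ ℓ ∈ Finset.Icc (ι + 1) k, lam ℓ / max (lam ℓ) (avgTail k s lam ι) =
      (s : ℝ) - ι := by
    rw [Finset.sum_congr rfl (g := fun ℓ => lam ℓ / avgTail k s lam ι)]
    · rw [← Finset.sum_div, hι.sum_eq, mul_div_cancel_right₀ _ ha.ne']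
    · intro ℓ hℓ
      obtain ⟨h1, h2⟩ := Finset.mem_Icc.1 hℓ
      rw [hι.max_eq_right hanti h1 h2]
  rw [e1, e2]
  ring

lemma IsIota.isThreshold (hι : IsIota k s lam ι) (hsk : s ≤ k) (hlam : ∀ i, 0 ≤ lam i)
    (hanti : ∀ i j, 1 ≤ i → i ≤ j → j ≤ k → lam j ≤ lam i) (hpos : 0 < lam s) :
    IsThreshold s (fun j : Fin k => lam ((j : ℕ) + 1)) (avgTail k s lam ι) := by
  have ha := hι.avgTail_pos hsk hanti hpos
  refine ⟨ha, hι.sum_div_max hsk hanti hpos, fun c hc => ?_⟩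
  rw [← hι.sum_div_max hsk hanti hpos]
  have hιs := hι.1
  refine Finset.sum_lt_sum (fun j _ => div_max_anti ha hc.le (hlam _))
    ⟨⟨ι, by omega⟩, Finset.mem_univ _, ?_⟩
  have h0 : 0 < lam (ι + 1) := hpos.trans_le (hanti _ _ (by omega) (by omega) hsk)
  refine div_lt_div_of_pos_left h0 (lt_max_of_lt_right ha) ?_
  dsimp only
  rw [_root_.max_eq_right hι.2.2]
  exact lt_max_of_lt_right hc

lemma IsIota.capObjective_eq (hι : IsIota k s lam ι) (hsk : s ≤ k)
    (hanti : ∀ i j, 1 ≤ i → i ≤ j → j ≤ k → lam j ≤ lam i) (hpos : 0 < lam s) :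
    capObjective s (avgTail k s lam ι) (fun j : Fin k => lam ((j : ℕ) + 1)) =
      ∑ ℓ ∈ Finset.Icc 1 ι, Real.log (lam ℓ) +
        ((s : ℝ) - ι) * Real.log (avgTail k s lam ι) := by
  have hιs := hι.1
  have h := hι.sum_div_max hsk hanti hpos
  unfold cappedSum at h
  rw [capObjective, Finset.sum_add_distrib, h,
    sum_fin_succ_eq_sum_Icc (show ι ≤ k by omega)
    (fun ℓ => Real.log (max (lam ℓ) (avgTail k s lam ι)))]
  have e1 : ∑ ℓ ∈ Finset.Icc 1 ι, Real.log (max (lam ℓ) (avgTail k s lam ι)) =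
      ∑ ℓ ∈ Finset.Icc 1 ι, Real.log (lam ℓ) := by
    refine Finset.sum_congr rfl fun ℓ hℓ => ?_
    obtain ⟨h1, h2⟩ := Finset.mem_Icc.1 hℓ
    rw [hι.max_eq_left hsk hanti h1 h2]
  have e2 : ∑ ℓ ∈ Finset.Icc (ι + 1) k, Real.log (max (lam ℓ) (avgTail k s lam ι)) =
      ((k : ℝ) - ι) * Real.log (avgTail k s lam ι) := by
    rw [Finset.sum_congr rfl (g := fun _ => Real.log (avgTail k s lam ι))]
    · rw [Finset.sum_const, Nat.card_Icc, nsmul_eq_mul, Nat.add_sub_add_right,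
        Nat.cast_sub (by omega)]
    · intro ℓ hℓ
      obtain ⟨h1, h2⟩ := Finset.mem_Icc.1 hℓ
      rw [hι.max_eq_right hanti h1 h2]
  rw [e1, e2]
  ring

lemma betaOf_eq (hs0 : 0 < s) (hsk : s ≤ k) (hlam : ∀ i, 0 ≤ lam i)
    (hanti : ∀ i j, 1 ≤ i → i ≤ j → j ≤ k → lam j ≤ lam i) :
    betaOf k s lam = fun j : Fin k =>
      (max (lam ((j : ℕ) + 1)) (avgTail k s lam (iotaOf k s lam)))⁻¹ := by
  have hι := isIota_iotaOf hs0 hsk hlam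
  funext j
  unfold betaOf
  split_ifs with hj
  · rw [hι.max_eq_left hsk hanti (by omega) hj]
  · rw [hι.max_eq_right hanti (by omega) (by omega), avgTail, inv_div]

end Iota

section Spectral

variable {n k k' : ℕ}

/-- Spectral decompositions give a coupling of the two spectra. -/
lemma isCoupling_sq_entries {Q P : Matrix (Fin k) (Fin k) ℝ} (hQ : Q * Qᵀ = 1)
    (hP : P * Pᵀ = 1) : IsCoupling fun i j => (Qᵀ * P) i j ^ 2 := by
  have h1 : (Qᵀ * P) * (Qᵀ * P)ᵀ = 1 := by
    rw [transpose_mul, transpose_transpose, Matrix.mul_assoc, ← Matrix.mul_assoc P, hP,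
      Matrix.one_mul, mul_eq_one_comm.1 hQ]
  have h2 : (Qᵀ * P)ᵀ * (Qᵀ * P) = 1 := mul_eq_one_comm.1 h1
  refine ⟨fun i j => sq_nonneg _, fun i => ?_, fun j => ?_⟩
  · have := congrFun (congrFun h1 i) i
    rw [Matrix.mul_apply, one_apply_eq] at this
    simpa [sq] using this
  · have := congrFun (congrFun h2 j) j
    rw [Matrix.mul_apply, one_apply_eq] at this
    simpa [sq] using this

lemma trace_conj_diagonal_mul_conj_diagonal (Q P : Matrix (Fin k) (Fin k) ℝ)
    (f g : Fin k → ℝ) :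
    (Q * diagonal f * Qᵀ * (P * diagonal g * Pᵀ)).trace =
      ∑ i, ∑ j, (Qᵀ * P) i j ^ 2 * (f i * g j) := by
  have h : (Q * diagonal f * Qᵀ * (P * diagonal g * Pᵀ)).trace =
      ((diagonal f * (Qᵀ * P)) * (diagonal g * (Qᵀ * P)ᵀ)).trace := by
    rw [transpose_mul, transpose_transpose, Matrix.mul_assoc Q, Matrix.mul_assoc Q,
      trace_mul_comm]
    simp only [Matrix.mul_assoc]
  rw [h, trace]
  refine Finset.sum_congr rfl fun i _ => ?_
  rw [diag_apply, Matrix.mul_apply]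
  refine Finset.sum_congr rfl fun j _ => ?_
  rw [diagonal_mul, diagonal_mul, transpose_apply]
  ring

lemma conj_diagonal_mul_conj_diagonal {Q : Matrix (Fin k) (Fin k) ℝ} (hQ : Q * Qᵀ = 1)
    (f g : Fin k → ℝ) :
    Q * diagonal f * Qᵀ * (Q * diagonal g * Qᵀ) = Q * diagonal (fun i => f i * g i) * Qᵀ := by
  rw [← diagonal_mul_diagonal]
  calc _ = Q * diagonal f * (Qᵀ * Q) * diagonal g * Qᵀ := by simp only [Matrix.mul_assoc]
    _ = _ := by rw [mul_eq_one_comm.1 hQ]; simp only [Matrix.mul_assoc, Matrix.one_mul]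

lemma trace_conj_diagonal {Q : Matrix (Fin k) (Fin k) ℝ} (hQ : Q * Qᵀ = 1) (f : Fin k → ℝ) :
    (Q * diagonal f * Qᵀ).trace = ∑ i, f i := by
  rw [trace_mul_comm, ← Matrix.mul_assoc, mul_eq_one_comm.1 hQ, Matrix.one_mul, trace_diagonal]

variable {Q P : Matrix (Fin k) (Fin k) ℝ} {L M : Fin k → ℝ}

lemma trace_conj_diagonal_mul_sub (hQ : Q * Qᵀ = 1) (hP : P * Pᵀ = 1) (f : Fin k → ℝ) :
    (Q * diagonal f * Qᵀ * (P * diagonal M * Pᵀ - Q * diagonal L * Qᵀ)).trace =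
      ∑ i, ∑ j, (Qᵀ * P) i j ^ 2 * (f i * (M j - L i)) := by
  rw [Matrix.mul_sub, trace_sub, conj_diagonal_mul_conj_diagonal hQ, trace_conj_diagonal hQ,
    trace_conj_diagonal_mul_conj_diagonal,
    ← (isCoupling_sq_entries hQ hP).sum_left (fun i => f i * L i),
    ← Finset.sum_sub_distrib]
  refine Finset.sum_congr rfl fun i _ => ?_
  rw [← Finset.sum_sub_distrib]
  refine Finset.sum_congr rfl fun j _ => ?_
  ring

lemma sum_sq_sub_eq (hQ : Q * Qᵀ = 1) (hP : P * Pᵀ = 1) :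
    ∑ i, ∑ j, (Qᵀ * P) i j ^ 2 * (L i - M j) ^ 2 =
      ∑ p, ∑ q, (P * diagonal M * Pᵀ - Q * diagonal L * Qᵀ) p q ^ 2 := by
  have hw := isCoupling_sq_entries hQ hP
  set X := Q * diagonal L * Qᵀ with hX
  set Y := P * diagonal M * Pᵀ with hY
  have hsymm : (Y - X)ᵀ = Y - X := by
    rw [hX, hY]
    simp only [transpose_sub, transpose_mul, transpose_transpose, diagonal_transpose,
      Matrix.mul_assoc]
  have h1 : ∑ p, ∑ q, (Y - X) p q ^ 2 = ((Y - X) * (Y - X)).trace := by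
    rw [trace]
    refine Finset.sum_congr rfl fun p _ => ?_
    rw [diag_apply, Matrix.mul_apply]
    refine Finset.sum_congr rfl fun q _ => ?_
    rw [sq, show (Y - X) q p = (Y - X) p q from congrFun (congrFun hsymm p) q]
  have h2 : ((Y - X) * (Y - X)).trace = (Y * Y).trace - 2 * (X * Y).trace + (X * X).trace := by
    rw [Matrix.sub_mul, Matrix.mul_sub, Matrix.mul_sub, trace_sub, trace_sub, trace_sub,
      trace_mul_comm Y X]
    ring
  rw [h1, h2, hX, hY, conj_diagonal_mul_conj_diagonal hQ, conj_diagonal_mul_conj_diagonal hP,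
    trace_conj_diagonal hQ, trace_conj_diagonal hP, trace_conj_diagonal_mul_conj_diagonal,
    ← hw.sum_left (fun i => L i * L i), ← hw.sum_right (fun j => M j * M j), Finset.mul_sum,
    ← Finset.sum_sub_distrib, ← Finset.sum_add_distrib]
  refine Finset.sum_congr rfl fun i _ => ?_
  rw [Finset.mul_sum, ← Finset.sum_sub_distrib, ← Finset.sum_add_distrib]
  refine Finset.sum_congr rfl fun j _ => ?_
  ring

lemma aeval_conj_diagonal (hQ : Q * Qᵀ = 1) (p : Polynomial ℝ) :
    Polynomial.aeval (Q * diagonal L * Qᵀ) p = Q * diagonal (fun i => p.eval (L i)) * Qᵀ := by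
  induction p using Polynomial.induction_on' with
  | add p q hp hq =>
    rw [map_add, hp, hq, ← Matrix.add_mul, ← Matrix.mul_add, diagonal_add]
    simp only [Polynomial.eval_add]
  | monomial m c =>
    have hpow : (Q * diagonal L * Qᵀ) ^ m = Q * diagonal (fun i => L i ^ m) * Qᵀ := by
      induction m with
      | zero => simp [hQ]
      | succ m ih =>
        rw [pow_succ, ih, conj_diagonal_mul_conj_diagonal hQ]
        simp only [pow_succ]
    rw [Polynomial.aeval_monomial, hpow, ← Algebra.smul_def, ← Matrix.smul_mul,
      ← Matrix.mul_smul, ← diagonal_smul]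
    simp only [Polynomial.eval_monomial]
    rfl

lemma mul_aeval_comm {F : Matrix (Fin n) (Fin k) ℝ} (E : Matrix (Fin k) (Fin n) ℝ)
    (p : Polynomial ℝ) :
    F * Polynomial.aeval (E * F) p = Polynomial.aeval (F * E) p * F := by
  induction p using Polynomial.induction_on' with
  | add p q hp hq => rw [map_add, map_add, Matrix.mul_add, Matrix.add_mul, hp, hq]
  | monomial m c =>
    have hpow : F * (E * F) ^ m = (F * E) ^ m * F := by
      induction m with
      | zero => simp
      | succ m ih =>
        rw [pow_succ, ← Matrix.mul_assoc, ih, pow_succ]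
        simp only [Matrix.mul_assoc]
    rw [Polynomial.aeval_monomial, Polynomial.aeval_monomial, ← Algebra.smul_def,
      ← Algebra.smul_def, Matrix.mul_smul, Matrix.smul_mul, hpow]

/-- `F h(Fᵀ D F) Fᵀ` depends on `F` only through `F Fᵀ`. -/
lemma conj_spectral_eq_of_mul_transpose_eq {F : Matrix (Fin n) (Fin k) ℝ}
    {F' : Matrix (Fin n) (Fin k') ℝ} {Q' : Matrix (Fin k') (Fin k') ℝ} {L' : Fin k' → ℝ}
    {D : Matrix (Fin n) (Fin n) ℝ} (hFF : F * Fᵀ = F' * F'ᵀ) (hQ : Q * Qᵀ = 1)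
    (hQ' : Q' * Q'ᵀ = 1) (hX : Fᵀ * D * F = Q * diagonal L * Qᵀ)
    (hX' : F'ᵀ * D * F' = Q' * diagonal L' * Q'ᵀ) (h : ℝ → ℝ) :
    F * (Q * diagonal (fun i => h (L i)) * Qᵀ) * Fᵀ =
      F' * (Q' * diagonal (fun i => h (L' i)) * Q'ᵀ) * F'ᵀ := by
  let T : Finset ℝ := Finset.univ.image L ∪ Finset.univ.image L'
  let p := Lagrange.interpolate T id h
  have hp : ∀ t ∈ T, p.eval t = h t := fun t ht =>
    Lagrange.eval_interpolate_at_node (v := id) h Function.injective_id.injOn ht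
  have e : (fun i => h (L i)) = fun i => p.eval (L i) := by
    funext i
    exact (hp _ (Finset.mem_union_left _ (Finset.mem_image_of_mem _ (Finset.mem_univ _)))).symm
  have e' : (fun i => h (L' i)) = fun i => p.eval (L' i) := by
    funext i
    exact (hp _ (Finset.mem_union_right _ (Finset.mem_image_of_mem _ (Finset.mem_univ _)))).symm
  rw [e, e', ← aeval_conj_diagonal hQ, ← aeval_conj_diagonal hQ', ← hX, ← hX', mul_aeval_comm,
    mul_aeval_comm, Matrix.mul_assoc, Matrix.mul_assoc, ← Matrix.mul_assoc F,
    ← Matrix.mul_assoc F', hFF]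

lemma sum_mul_eq_trace {F : Matrix (Fin n) (Fin k) ℝ} {D : Matrix (Fin n) (Fin n) ℝ}
    (hQ : Q * Qᵀ = 1) (hX : Fᵀ * D * F = Q * diagonal L * Qᵀ) (f : Fin k → ℝ) :
    ∑ i, L i * f i = (D * (F * (Q * diagonal f * Qᵀ) * Fᵀ)).trace := by
  rw [← trace_conj_diagonal hQ, ← conj_diagonal_mul_conj_diagonal hQ, ← hX, Matrix.mul_assoc Fᵀ,
    Matrix.mul_assoc Fᵀ, trace_mul_comm Fᵀ]
  simp only [Matrix.mul_assoc]

lemma rank_conj_diagonal (hQ : Q * Qᵀ = 1) :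
    ((Q * diagonal L * Qᵀ).rank : ℝ) = ∑ i, L i * (L i)⁻¹ := by
  have hu : IsUnit Q.det := (isUnit_iff_isUnit_det Q).1 (IsUnit.of_mul_eq_one _ hQ)
  rw [rank_mul_eq_left_of_isUnit_det _ _ (by rwa [det_transpose]),
    rank_mul_eq_right_of_isUnit_det _ _ hu, rank_diagonal, Fintype.card_subtype,
    Finset.card_filter, Nat.cast_sum]
  refine Finset.sum_congr rfl fun i _ => ?_
  split_ifs with hi
  · rw [mul_inv_cancel₀ hi, Nat.cast_one]
  · rw [not_not.1 hi, zero_mul, Nat.cast_zero]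

lemma pos_of_le_sum_mul_inv {s : ℕ} {lam : ℕ → ℝ} (hs0 : 0 < s) (hlam : ∀ i, 0 ≤ lam i)
    (hanti : ∀ i j, 1 ≤ i → i ≤ j → j ≤ k → lam j ≤ lam i)
    (h : (s : ℝ) ≤ ∑ j : Fin k, lam ((j : ℕ) + 1) * (lam ((j : ℕ) + 1))⁻¹) : 0 < lam s := by
  refine (hlam s).lt_of_ne fun h0 => ?_
  have hle : ∑ j : Fin k, lam ((j : ℕ) + 1) * (lam ((j : ℕ) + 1))⁻¹ ≤
      ∑ j : Fin k, if (j : ℕ) ∈ Finset.range (s - 1) then (1 : ℝ) else 0 := by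
    refine Finset.sum_le_sum fun j _ => ?_
    split_ifs with hj
    · exact mul_inv_le_one
    · have hz : lam ((j : ℕ) + 1) = 0 :=
        le_antisymm (h0 ▸ hanti s _ hs0 (by rw [Finset.mem_range] at hj; omega) (by omega))
          (hlam _)
      rw [hz, zero_mul]
  rw [Fin.sum_univ_eq_sum_range (fun j => if j ∈ Finset.range (s - 1) then (1 : ℝ) else 0) k,
    Finset.sum_ite_mem, Finset.sum_const, nsmul_eq_mul, mul_one] at hle
  have hcard : (Finset.range k ∩ Finset.range (s - 1)).card ≤ s - 1 :=
    (Finset.card_le_card Finset.inter_subset_right).trans (Finset.card_range _).le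
  have h3 : (s : ℝ) ≤ ((s - 1 : ℕ) : ℝ) :=
    (h.trans hle).trans (by exact_mod_cast hcard)
  have : s ≤ s - 1 := by exact_mod_cast h3
  omega

lemma eigsDesc_eq {X : Matrix (Fin k) (Fin k) ℝ} (hX : X.IsHermitian) (j : Fin k) :
    eigsDesc k X ((j : ℕ) + 1) =
      hX.eigenvalues (Tuple.sort hX.eigenvalues (Fin.rev j)) := by
  have hsort : ((List.ofFn hX.eigenvalues : List ℝ) : Multiset ℝ).sort (· ≤ ·) =
      List.ofFn (hX.eigenvalues ∘ Tuple.sort hX.eigenvalues) := by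
    refine List.Perm.eq_of_pairwise' (Multiset.pairwise_sort _ _)
      (Tuple.monotone_sort hX.eigenvalues).sortedLE_ofFn.pairwise ?_
    refine List.Perm.trans ?_ (Equiv.Perm.ofFn_comp_perm _ _).symm
    exact Multiset.coe_eq_coe.1 (Multiset.sort_eq _ _)
  unfold eigsDesc
  rw [dif_pos hX, hsort, Nat.add_sub_cancel, List.getD_eq_getElem _ _ (by simp)]
  rw [List.getElem_reverse, List.getElem_ofFn]
  simp only [Function.comp_apply]
  congr 2
  ext
  simp [Fin.rev]
  omega

lemma eigsDesc_nonneg {X : Matrix (Fin k) (Fin k) ℝ} (hX : X.PosSemidef) (i : ℕ) :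
    0 ≤ eigsDesc k X i := by
  by_cases hi : i - 1 < k
  · have h := eigsDesc_eq hX.isHermitian ⟨i - 1, hi⟩
    have e : eigsDesc k X i = eigsDesc k X (i - 1 + 1) := by
      unfold eigsDesc
      rw [Nat.add_sub_cancel]
    rw [e, h]
    exact hX.eigenvalues_nonneg _
  · unfold eigsDesc
    rw [dif_pos hX.isHermitian, List.getD_eq_default]
    simpa using hi

lemma eigsDesc_anti {X : Matrix (Fin k) (Fin k) ℝ} (hX : X.IsHermitian) (i j : ℕ) (hi : 1 ≤ i)
    (hij : i ≤ j) (hj : j ≤ k) : eigsDesc k X j ≤ eigsDesc k X i := by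
  obtain ⟨i, rfl⟩ := Nat.exists_eq_add_of_le' hi
  obtain ⟨j, rfl⟩ := Nat.exists_eq_add_of_le' (hi.trans hij)
  have h1 := eigsDesc_eq hX ⟨i, by omega⟩
  have h2 := eigsDesc_eq hX ⟨j, by omega⟩
  dsimp only at h1 h2
  rw [h1, h2]
  refine Tuple.monotone_sort hX.eigenvalues (Fin.rev_le_rev.2 ?_)
  exact Fin.mk_le_mk.2 (by omega)

lemma exists_conj_diagonal_eigsDesc {X : Matrix (Fin k) (Fin k) ℝ} (hX : X.IsHermitian) :
    ∃ P : Matrix (Fin k) (Fin k) ℝ, P * Pᵀ = 1 ∧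
      X = P * diagonal (fun j : Fin k => eigsDesc k X ((j : ℕ) + 1)) * Pᵀ := by
  let σ : Equiv.Perm (Fin k) := Fin.revPerm.trans (Tuple.sort hX.eigenvalues)
  let U : Matrix (Fin k) (Fin k) ℝ := hX.eigenvectorUnitary
  have hU : U * Uᵀ = 1 := by
    have := Unitary.coe_mul_star_self hX.eigenvectorUnitary
    rwa [Unitary.coe_star, star_eq_conjTranspose, conjTranspose_eq_transpose_of_trivial] at this
  refine ⟨U.submatrix id σ, ?_, ?_⟩
  · rw [transpose_submatrix, submatrix_mul_equiv, hU, submatrix_id_id]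
  · have hd : diagonal (fun j : Fin k => eigsDesc k X ((j : ℕ) + 1)) =
        (diagonal hX.eigenvalues).submatrix σ σ := by
      rw [submatrix_diagonal_equiv]
      congr 1
      funext j
      exact eigsDesc_eq hX j
    rw [hd, transpose_submatrix, submatrix_mul_equiv, submatrix_mul_equiv, submatrix_id_id]
    have := hX.spectral_theorem
    rw [Unitary.conjStarAlgAut_apply, star_eq_conjTranspose,
      conjTranspose_eq_transpose_of_trivial] at this
    exact this

end Spectral

section Gradient

variable {n k k' s : ℕ} {F : Matrix (Fin n) (Fin k) ℝ} {x y Υ : Fin n → ℝ}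
  {Q : Matrix (Fin k) (Fin k) ℝ} {lam : ℕ → ℝ}

lemma posSemidef_FDD (hΥ : ∀ i, 0 < Υ i) (hx : ∀ i, 0 ≤ x i) : (FDD n k F x Υ).PosSemidef := by
  have h : (diagonal fun i => Υ i * x i).PosSemidef :=
    PosSemidef.diagonal fun i => mul_nonneg (hΥ i).le (hx i)
  have := h.conjTranspose_mul_mul_same F
  rwa [conjTranspose_eq_transpose_of_trivial] at this

lemma FDD_sub_apply (p q : Fin k) :
    (FDD n k F y Υ - FDD n k F x Υ) p q = ∑ i, F i p * Υ i * F i q * (y i - x i) := by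
  rw [Matrix.sub_apply, FDD, FDD, Matrix.mul_apply, Matrix.mul_apply, ← Finset.sum_sub_distrib]
  refine Finset.sum_congr rfl fun i _ => ?_
  rw [mul_diagonal, mul_diagonal, transpose_apply]
  ring

lemma exists_frobenius_FDD_sub_le (F : Matrix (Fin n) (Fin k) ℝ) (Υ : Fin n → ℝ) :
    ∃ K > 0, ∀ x y : Fin n → ℝ,
      √(∑ p, ∑ q, (FDD n k F y Υ - FDD n k F x Υ) p q ^ 2) ≤ K * enorm2 n (y - x) := by
  set S := ∑ p, ∑ q, ∑ i, (F i p * Υ i * F i q) ^ 2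
  refine ⟨√S + 1, by positivity, fun x y => ?_⟩
  have h : ∑ p, ∑ q, (FDD n k F y Υ - FDD n k F x Υ) p q ^ 2 ≤
      S * ∑ i, ((y - x) i) ^ 2 := by
    rw [Finset.sum_mul]
    refine Finset.sum_le_sum fun p _ => ?_
    rw [Finset.sum_mul]
    refine Finset.sum_le_sum fun q _ => ?_
    rw [FDD_sub_apply]
    exact Finset.sum_mul_sq_le_sq_mul_sq _ _ _
  calc _ ≤ √(S * ∑ i, ((y - x) i) ^ 2) := Real.sqrt_le_sqrt h
    _ = √S * enorm2 n (y - x) := Real.sqrt_mul (by positivity) _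
    _ ≤ _ := mul_le_mul_of_nonneg_right (by linarith) (Real.sqrt_nonneg _)

lemma sum_mul_diag_eq_trace (H : Matrix (Fin k) (Fin k) ℝ) :
    ∑ i, Υ i * (F * H * Fᵀ) i i * (y i - x i) =
      (H * (FDD n k F y Υ - FDD n k F x Υ)).trace := by
  have h : FDD n k F y Υ - FDD n k F x Υ = Fᵀ * (diagonal (fun i => Υ i * (y i - x i)) * F) := by
    ext p q
    rw [FDD_sub_apply, Matrix.mul_apply]
    refine Finset.sum_congr rfl fun i _ => ?_
    rw [diagonal_mul, transpose_apply]
    ring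
  rw [h, ← Matrix.mul_assoc, ← Matrix.mul_assoc, trace_mul_comm, ← Matrix.mul_assoc,
    ← Matrix.mul_assoc, trace]
  refine Finset.sum_congr rfl fun i _ => ?_
  rw [diag_apply, mul_diagonal]
  ring

lemma IsSpectralDecomp.lam_pos (h : IsSpectralDecomp n k F x Υ Q lam) (hs0 : 0 < s)
    (hr : s ≤ (FDD n k F x Υ).rank) : 0 < lam s := by
  obtain ⟨hQ, hX, hlam, hanti⟩ := h
  refine pos_of_le_sum_mul_inv hs0 hlam hanti ?_
  rw [← rank_conj_diagonal (L := fun j : Fin k => lam ((j : ℕ) + 1)) hQ, ← hX]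
  exact_mod_cast hr

lemma gMat_eq (h : IsSpectralDecomp n k F x Υ Q lam) (hs0 : 0 < s) (hsk : s ≤ k) :
    gMat n k s F Q lam = F * (Q * diagonal (fun j : Fin k =>
      (max (lam ((j : ℕ) + 1)) (avgTail k s lam (iotaOf k s lam)))⁻¹) * Qᵀ) * Fᵀ := by
  obtain ⟨-, -, hlam, hanti⟩ := h
  rw [gMat, betaOf_eq hs0 hsk hlam hanti]
  simp only [Matrix.mul_assoc]

lemma IsSpectralDecomp.isThreshold (h : IsSpectralDecomp n k F x Υ Q lam) (hs0 : 0 < s)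
    (hsk : s ≤ k) (hpos : 0 < lam s) :
    IsThreshold s (fun j : Fin k => lam ((j : ℕ) + 1)) (avgTail k s lam (iotaOf k s lam)) :=
  (isIota_iotaOf hs0 hsk h.2.2.1).isThreshold hsk h.2.2.1 h.2.2.2 hpos

lemma IsSpectralDecomp.capObjective_eq_phiS (h : IsSpectralDecomp n k F x Υ Q lam)
    (hs0 : 0 < s) (hsk : s ≤ k) (hpos : 0 < lam s) :
    capObjective s (avgTail k s lam (iotaOf k s lam)) (fun j : Fin k => lam ((j : ℕ) + 1)) =
      phiS k s lam :=
  (isIota_iotaOf hs0 hsk h.2.2.1).capObjective_eq hsk h.2.2.2 hpos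

lemma exists_isSpectralDecomp_eigsDesc (hΥ : ∀ i, 0 < Υ i) (hx : ∀ i, 0 ≤ x i) :
    ∃ P, IsSpectralDecomp n k F x Υ P (eigsDesc k (FDD n k F x Υ)) := by
  have hX := posSemidef_FDD (F := F) hΥ hx
  obtain ⟨P, hP, hPX⟩ := exists_conj_diagonal_eigsDesc hX.isHermitian
  exact ⟨P, hP, hPX, eigsDesc_nonneg hX, eigsDesc_anti hX.isHermitian⟩

/-- `gMat` does not depend on the factorization or on the spectral decomposition. -/
lemma gMat_eq_gMat {F' : Matrix (Fin n) (Fin k') ℝ} {Q' : Matrix (Fin k') (Fin k') ℝ}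
    {lam' : ℕ → ℝ} (hFF : F * Fᵀ = F' * F'ᵀ) (hs0 : 0 < s) (hsk : s ≤ k) (hsk' : s ≤ k')
    (hr : s ≤ (FDD n k F x Υ).rank) (h : IsSpectralDecomp n k F x Υ Q lam)
    (h' : IsSpectralDecomp n k' F' x Υ Q' lam') :
    gMat n k s F Q lam = gMat n k' s F' Q' lam' := by
  have hinv := conj_spectral_eq_of_mul_transpose_eq hFF h.1 h'.1 h.2.1 h'.2.1
  have hsum : ∀ g : ℝ → ℝ, ∑ j : Fin k, lam ((j : ℕ) + 1) * g (lam ((j : ℕ) + 1)) =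
      ∑ j : Fin k', lam' ((j : ℕ) + 1) * g (lam' ((j : ℕ) + 1)) := fun g => by
    rw [sum_mul_eq_trace (L := fun j : Fin k => lam ((j : ℕ) + 1)) h.1 h.2.1
        (fun j => g (lam ((j : ℕ) + 1))),
      sum_mul_eq_trace (L := fun j : Fin k' => lam' ((j : ℕ) + 1)) h'.1 h'.2.1
        (fun j => g (lam' ((j : ℕ) + 1))), hinv g]
  have hpos := h.lam_pos hs0 hr
  have hpos' : 0 < lam' s := by
    refine pos_of_le_sum_mul_inv hs0 h'.2.2.1 h'.2.2.2 ?_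
    rw [← hsum fun t => t⁻¹,
      ← rank_conj_diagonal (L := fun j : Fin k => lam ((j : ℕ) + 1)) h.1, ← h.2.1]
    exact_mod_cast hr
  have ha : avgTail k s lam (iotaOf k s lam) = avgTail k' s lam' (iotaOf k' s lam') :=
    (h.isThreshold hs0 hsk hpos).eq_of_cappedSum_eq (h'.isThreshold hs0 hsk' hpos')
      fun c _ => by simpa only [cappedSum, div_eq_mul_inv] using hsum fun t => (max t c)⁻¹
  rw [gMat_eq h hs0 hsk, gMat_eq h' hs0 hsk', ← ha]
  exact hinv fun t => (max t (avgTail k s lam (iotaOf k s lam)))⁻¹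

end Gradient

/-- Theorem 3.iii: `f_DDFact(·;Υ)` is generalized differentiable at every
`x ∈ dom(f_DDFact;Υ)₊` with respect to `dom(f_DDFact;Υ)₊`, with generalized gradient
`g_x(x;Υ) = Υ ∘ diag(F Q Diag(β) Qᵀ Fᵀ) − log Υ`; moreover the generalized gradient is
invariant to the choices of `F` and `Q` (with `β` adjusted accordingly). -/
theorem stmt_11 (n k s r : ℕ) (hn : 1 < n) (hs0 : 0 < s) (hsn : s < n)
    (C : Matrix (Fin n) (Fin n) ℝ) (hC : C.PosSemidef)
    (hr : C.rank = r) (hrs : s ≤ r)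
    (F : Matrix (Fin n) (Fin k) ℝ) (hF : C = F * Fᵀ) (hk1 : r ≤ k) (hk2 : k ≤ n)
    (Υ : Fin n → ℝ) (hΥ : ∀ i, 0 < Υ i)
    (x : Fin n → ℝ) (hx0 : ∀ i, 0 ≤ x i) (hxr : s ≤ (FDD n k F x Υ).rank)
    (Q : Matrix (Fin k) (Fin k) ℝ) (lam : ℕ → ℝ)
    (hdec : IsSpectralDecomp n k F x Υ Q lam) :
    (∀ ε > (0 : ℝ), ∃ δ > (0 : ℝ), ∀ y : Fin n → ℝ,
      (∀ i, 0 ≤ y i) → s ≤ (FDD n k F y Υ).rank → enorm2 n (y - x) < δ →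
      |fDD n k s F y Υ - fDD n k s F x Υ -
        ∑ i, (Υ i * (gMat n k s F Q lam) i i - Real.log (Υ i)) * (y i - x i)|
        ≤ ε * enorm2 n (y - x)) ∧
    (∀ (k' : ℕ) (F' : Matrix (Fin n) (Fin k') ℝ) (Q' : Matrix (Fin k') (Fin k') ℝ)
        (lam' : ℕ → ℝ), C = F' * F'ᵀ → r ≤ k' → k' ≤ n →
        IsSpectralDecomp n k' F' x Υ Q' lam' →
        ∀ i, (gMat n k s F Q lam) i i = (gMat n k' s F' Q' lam') i i) := by
  have hsk : s ≤ k := hrs.trans hk1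
  refine ⟨fun ε hε => ?_, fun k' F' Q' lam' hF' hk1' _ hdec' i => ?_⟩
  · obtain ⟨P, hP⟩ := exists_isSpectralDecomp_eigsDesc (F := F) hΥ hx0
    rw [gMat_eq_gMat rfl hs0 hsk hsk hxr hdec hP, gMat_eq hP hs0 hsk]
    have hpos := hP.lam_pos hs0 hxr
    obtain ⟨K, hK, hfrob⟩ := exists_frobenius_FDD_sub_le F Υ
    obtain ⟨ρ, hρ, H⟩ := (hP.isThreshold hs0 hsk hpos).abs_capObjective_sub_le
      (fun j => hP.2.2.1 _) (div_pos hε hK)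
    refine ⟨ρ / K, div_pos hρ hK, fun y hy0 hyr hxy => ?_⟩
    obtain ⟨R, hR⟩ := exists_isSpectralDecomp_eigsDesc (F := F) hΥ hy0
    have hposy := hR.lam_pos hs0 hyr
    have hfro := sum_sq_sub_eq (L := fun j : Fin k => eigsDesc k (FDD n k F x Υ) ((j : ℕ) + 1))
      (M := fun j : Fin k => eigsDesc k (FDD n k F y Υ) ((j : ℕ) + 1)) hP.1 hR.1
    rw [← hP.2.1, ← hR.2.1] at hfro
    have hle := hfrob x y
    have hlt := hle.trans_lt ((lt_div_iff₀' hK).1 hxy)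
    rw [← hfro] at hle hlt
    have key := H _ _ _ (fun j => hR.2.2.1 _) (isCoupling_sq_entries hP.1 hR.1)
      (hR.isThreshold hs0 hsk hposy) hlt
    rw [hR.capObjective_eq_phiS hs0 hsk hposy, hP.capObjective_eq_phiS hs0 hsk hpos,
      ← trace_conj_diagonal_mul_sub hP.1 hR.1, ← hP.2.1, ← hR.2.1,
      ← sum_mul_diag_eq_trace] at key
    refine (le_of_eq ?_).trans (key.trans ?_)
    · congr 1
      have hlog : ∑ i, Real.log (Υ i) * (y i - x i) =
          ∑ i, y i * Real.log (Υ i) - ∑ i, x i * Real.log (Υ i) := by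
        rw [← Finset.sum_sub_distrib]
        exact Finset.sum_congr rfl fun i _ => by ring
      simp only [sub_mul, Finset.sum_sub_distrib, hlog, fDD, gammaS]
      ring
    · calc _ ≤ ε / K * (K * enorm2 n (y - x)) :=
            mul_le_mul_of_nonneg_left hle (div_pos hε hK).le
        _ = ε * enorm2 n (y - x) := by field_simp
  · rw [gMat_eq_gMat (hF.symm.trans hF') hs0 hsk (hrs.trans hk1') hxr hdec hdec']

end
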